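/- Let m be a positive integer, χ a Dirichlet character modulo m, s ∈ ℂ, and N ≥ 1 an integer. With W(x) = (π/(2m)) Σ_{n=1}^{2m} χ(n) e^{-iπ n²/m} cot(π (x−n)/(2m)) define, for c > 0 with c ∉ ℤ, Λ(c) = −e^{iπ/4} ∫_{-∞}^{∞} e^{(iπ/m) x(t)²} x(t)^{-s} W(x(t)) dt, where x(t) = c + e^{iπ/4} t and the power is principal. Then (1/(2πi)) · ( Λ(N − 1/2) − Λ(N + 1/2) ) = χ(N) · N^{-s}. -/

import Mathlib

open Real
open Complex (I)

/-- Siegel's function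
`W(x) = (π/(2m)) Σ_{n=1}^{2m} χ(n) e^{-iπn²/m} cot(π(x-n)/(2m))`
attached to a Dirichlet character `χ` modulo `m`. -/
noncomputable def siegelW (m : ℕ) (χ : DirichletCharacter ℂ m) (x : ℂ) : ℂ :=
  ((π : ℂ) / (2 * (m : ℂ))) *
    ∑ n ∈ Finset.Icc 1 (2 * m),
      χ (n : ZMod m) * Complex.exp (-(I * (π : ℂ) * (n : ℂ) ^ 2 / (m : ℂ))) *
        Complex.cot ((π : ℂ) * (x - (n : ℂ)) / (2 * (m : ℂ)))

/-- The contour integral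
`Λ(c) = -e^{iπ/4} ∫_ℝ e^{(iπ/m)x(t)²} x(t)^{-s} W(x(t)) dt`
along the line `x(t) = c + e^{iπ/4}t` crossing the positive real axis at `c`,
traversed downward from the first quadrant to the third quadrant. -/
noncomputable def siegelLambda (m : ℕ) (χ : DirichletCharacter ℂ m) (s : ℂ)
    (c : ℝ) : ℂ :=
  -(Complex.exp (I * (π : ℂ) / 4) *
    ∫ t : ℝ,
      Complex.exp ((I * (π : ℂ) / (m : ℂ))
          * ((c : ℂ) + Complex.exp (I * (π : ℂ) / 4) * (t : ℂ)) ^ 2) *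
        ((c : ℂ) + Complex.exp (I * (π : ℂ) / 4) * (t : ℂ)) ^ (-s) *
        siegelW m χ ((c : ℂ) + Complex.exp (I * (π : ℂ) / 4) * (t : ℂ)))

open MeasureTheory Filter Topology

/-- The difference of the Cauchy kernel on two parallel lines on both sides of its pole. -/
lemma inv_sub_mul_I_sub_inv_add_mul_I {a : ℝ} (ha : 0 < a) (t : ℝ) :
    ((t : ℂ) + ((-a : ℝ) : ℂ) * I)⁻¹ - ((t : ℂ) + (a : ℂ) * I)⁻¹
      = ((2 * a⁻¹ * (1 + (a⁻¹ * t) ^ 2)⁻¹ : ℝ) : ℂ) * I := by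
  have h (b : ℝ) (hb : b ≠ 0) : (t : ℂ) + (b : ℂ) * I ≠ 0 := fun h0 ↦ hb <| by
    simpa using congrArg Complex.im h0
  have h1 := h (-a) (by linarith)
  have h2 := h a ha.ne'
  have hr : (1 + (a⁻¹ * t) ^ 2 : ℝ) ≠ 0 := by positivity
  have h3 : (1 + ((a : ℂ)⁻¹ * t) ^ 2) ≠ 0 := by exact_mod_cast hr
  have ha' : (a : ℂ) ≠ 0 := by exact_mod_cast ha.ne'
  have key : ((t : ℂ) + ((-a : ℝ) : ℂ) * I) * ((t : ℂ) + (a : ℂ) * I)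
      = a ^ 2 * (1 + ((a : ℂ)⁻¹ * t) ^ 2) := by
    push_cast
    field_simp
    linear_combination (-(a : ℂ) ^ 2) * Complex.I_sq
  rw [inv_sub_inv h1 h2, key]
  push_cast
  field_simp
  ring

lemma integral_inv_sub_mul_I_sub_inv_add_mul_I {a : ℝ} (ha : 0 < a) :
    ∫ t : ℝ, (((t : ℂ) + ((-a : ℝ) : ℂ) * I)⁻¹ - ((t : ℂ) + (a : ℂ) * I)⁻¹) = 2 * π * I := by
  simp_rw [inv_sub_mul_I_sub_inv_add_mul_I ha]
  rw [integral_mul_const, integral_complex_ofReal, integral_const_mul,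
    Measure.integral_comp_mul_left (fun x : ℝ ↦ (1 + x ^ 2)⁻¹), integral_univ_inv_one_add_sq,
    inv_inv, abs_of_pos ha, smul_eq_mul]
  congr 1
  push_cast
  have ha' : (a : ℂ) ≠ 0 := by exact_mod_cast ha.ne'
  field_simp

lemma integrable_inv_sub_mul_I_sub_inv_add_mul_I {a : ℝ} (ha : 0 < a) :
    Integrable fun t : ℝ ↦
      (((t : ℂ) + ((-a : ℝ) : ℂ) * I)⁻¹ - ((t : ℂ) + (a : ℂ) * I)⁻¹) := by
  simp_rw [inv_sub_mul_I_sub_inv_add_mul_I ha]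
  exact ((integrable_inv_one_add_sq.comp_mul_left' (inv_ne_zero ha.ne')).const_mul
    (2 * a⁻¹)).ofReal.mul_const I

lemma integrable_of_norm_le_mul_inv_one_add_sq {g : ℝ → ℂ} (hg : Continuous g) {C T₀ : ℝ}
    (h : ∀ t, T₀ ≤ |t| → ‖g t‖ ≤ C * (1 + t ^ 2)⁻¹) : Integrable g := by
  refine hg.locallyIntegrable.integrable_of_isBigO_cocompact (g := fun t : ℝ ↦ (1 + t ^ 2)⁻¹)
    (Asymptotics.IsBigO.of_bound C ?_)
    (integrable_inv_one_add_sq.integrableAtFilter _)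
  have h1 : ∀ᶠ t : ℝ in cocompact ℝ, T₀ ≤ ‖t‖ :=
    (tendsto_norm_cocompact_atTop (E := ℝ)).eventually_ge_atTop T₀
  filter_upwards [h1] with t ht
  rw [Real.norm_of_nonneg (by positivity : (0 : ℝ) ≤ (1 + t ^ 2)⁻¹)]
  exact h t ht

/-- **Residue theorem in a horizontal strip**, for a function with a single pole, which is simple
and located at the origin, and with quadratic decay at both ends of the strip. -/
theorem integral_sub_integral_strip_eq_residue {f : ℂ → ℂ} {r : ℂ} {a b C T₀ : ℝ} (ha : 0 < a)
    (hab : a < b)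
    (hf : DifferentiableOn ℂ f ({z : ℂ | |z.im| < b} \ {0}))
    (hr : Tendsto (fun z ↦ z * f z) (𝓝[≠] 0) (𝓝 r))
    (hdecay : ∀ t y : ℝ, |y| ≤ a → T₀ ≤ |t| → ‖f (t + y * I)‖ ≤ C * (1 + t ^ 2)⁻¹) :
    (∫ t : ℝ, f (t + ((-a : ℝ) : ℂ) * I)) - ∫ t : ℝ, f (t + (a : ℂ) * I) = 2 * π * I * r := by
  set U : Set ℂ := {z : ℂ | |z.im| < b} with hU
  have hUo : IsOpen U := isOpen_lt (Complex.continuous_im.abs) continuous_const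
  have hU0 : U ∈ 𝓝 (0 : ℂ) := hUo.mem_nhds (by simp [hU]; linarith)
  set k : ℂ → ℂ := Function.update (fun z ↦ z * f z) 0 r with hk
  have hkd : DifferentiableOn ℂ k U := by
    refine (Complex.differentiableOn_compl_singleton_and_continuousAt_iff hU0).1
      ⟨?_, continuousAt_update_same.2 hr⟩
    refine (differentiableOn_id.mul hf).congr fun z hz ↦ ?_
    simp [hk, Function.update_of_ne (show z ≠ 0 from hz.2)]
  set h : ℂ → ℂ := dslope k 0 with hh
  have hhd : DifferentiableOn ℂ h U := (Complex.differentiableOn_dslope hU0).2 hkd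
  have hhf : ∀ z : ℂ, z ≠ 0 → h z = f z - r * z⁻¹ := fun z hz ↦ by
    rw [hh, dslope_of_ne _ hz, slope_def_field]
    simp only [hk, Function.update_of_ne hz, Function.update_self]
    rw [sub_zero]
    field_simp
  have hne (t c : ℝ) (hc : c ≠ 0) : (t : ℂ) + (c : ℂ) * I ≠ 0 := fun h0 ↦ hc <| by
    simpa using congrArg Complex.im h0
  have hcont (c : ℝ) (hc : |c| = a) : Continuous fun t : ℝ ↦ h (t + (c : ℂ) * I) :=
    hhd.continuousOn.comp_continuous (by fun_prop) fun t ↦ by simp [hU, hc, hab]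
  have hfcont (c : ℝ) (hc : |c| = a) : Continuous fun t : ℝ ↦ f (t + (c : ℂ) * I) :=
    hf.continuousOn.comp_continuous (by fun_prop) fun t ↦
      ⟨by simp [hU, hc, hab], hne t c fun h0 ↦ by simp [h0] at hc; linarith⟩
  have hfint (c : ℝ) (hc : |c| = a) : Integrable fun t : ℝ ↦ f (t + (c : ℂ) * I) :=
    integrable_of_norm_le_mul_inv_one_add_sq (hfcont c hc) fun t ht ↦ hdecay t c hc.le ht
  have e1 : |(-a)| = a := by rw [abs_neg, abs_of_pos ha]
  have e2 : |a| = a := abs_of_pos ha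
  have hD (t : ℝ) : h (t + ((-a : ℝ) : ℂ) * I) - h (t + (a : ℂ) * I)
      = (f (t + ((-a : ℝ) : ℂ) * I) - f (t + (a : ℂ) * I))
        - r * (((t : ℂ) + ((-a : ℝ) : ℂ) * I)⁻¹ - ((t : ℂ) + (a : ℂ) * I)⁻¹) := by
    rw [hhf _ (hne t _ (by linarith)), hhf _ (hne t _ ha.ne')]
    ring
  have hi1 := (hfint _ e1).sub (hfint _ e2)
  have hi2 := (integrable_inv_sub_mul_I_sub_inv_add_mul_I ha).const_mul r
  have hDint : Integrable fun t : ℝ ↦ h (t + ((-a : ℝ) : ℂ) * I) - h (t + (a : ℂ) * I) := by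
    simp_rw [hD]
    exact hi1.sub hi2
  have hDval : ∫ t : ℝ, (h (t + ((-a : ℝ) : ℂ) * I) - h (t + (a : ℂ) * I))
      = ((∫ t : ℝ, f (t + ((-a : ℝ) : ℂ) * I)) - ∫ t : ℝ, f (t + (a : ℂ) * I))
        - r * (2 * π * I) := by
    simp_rw [hD]
    rw [← integral_inv_sub_mul_I_sub_inv_add_mul_I ha, ← integral_const_mul,
      ← integral_sub (hfint _ e1) (hfint _ e2)]
    exact integral_sub hi1 hi2
  have hlim := intervalIntegral_tendsto_integral hDint tendsto_neg_atTop_atBot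
    (tendsto_id (α := ℝ) (x := atTop))
  have hvert (T : ℝ) (hT : T ≠ 0) (hT0 : T₀ ≤ |T|) (hT1 : 1 ≤ |T|) :
      ‖∫ y in (-a)..a, h (T + y * I)‖ ≤ (C + ‖r‖) * |T|⁻¹ * |a - (-a)| := by
    refine intervalIntegral.norm_integral_le_of_norm_le_const fun y hy ↦ ?_
    rw [Set.uIoc_of_le (by linarith)] at hy
    have hz : (T : ℂ) + y * I ≠ 0 := fun h0 ↦ hT <| by simpa using congrArg Complex.re h0
    rw [hhf _ hz]
    have hTp : 0 < |T| := abs_pos.2 hT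
    have hb := hdecay T y (abs_le.2 ⟨hy.1.le, hy.2⟩) hT0
    have hC : 0 ≤ C := by
      have := (norm_nonneg _).trans hb
      exact nonneg_of_mul_nonneg_left this (by positivity)
    have h1 : (1 + T ^ 2)⁻¹ ≤ |T|⁻¹ := by
      apply inv_anti₀ hTp
      rw [← sq_abs]
      nlinarith
    have h2 : |T| ≤ ‖(T : ℂ) + y * I‖ := by
      simpa using Complex.abs_re_le_norm ((T : ℂ) + y * I)
    calc ‖f (T + y * I) - r * ((T : ℂ) + y * I)⁻¹‖
        ≤ ‖f (T + y * I)‖ + ‖r * ((T : ℂ) + y * I)⁻¹‖ := norm_sub_le _ _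
      _ ≤ C * |T|⁻¹ + ‖r‖ * |T|⁻¹ := by
          rw [norm_mul, norm_inv]
          gcongr
          exact hb.trans (by gcongr)
      _ = (C + ‖r‖) * |T|⁻¹ := by ring
  have hrect (T : ℝ) : ∫ t in (-T)..T, (h (t + ((-a : ℝ) : ℂ) * I) - h (t + (a : ℂ) * I))
      = I * (∫ y in (-a)..a, h (((-T : ℝ) : ℂ) + y * I))
        - I * ∫ y in (-a)..a, h ((T : ℂ) + y * I) := by
    have := Complex.integral_boundary_rect_eq_zero_of_differentiableOn h ⟨-T, -a⟩ ⟨T, a⟩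
      (hhd.mono fun z hz ↦ by
        have := hz.2
        simp only [Set.mem_preimage, Set.uIcc_of_le (show -a ≤ a by linarith)] at this
        exact (abs_le.2 this).trans_lt hab)
    simp only [smul_eq_mul] at this
    rw [intervalIntegral.integral_sub ((hcont _ e1).intervalIntegrable _ _)
      ((hcont _ e2).intervalIntegrable _ _)]
    linear_combination this
  have hlim0 : Tendsto
      (fun T : ℝ ↦ ∫ t in (-T)..T, (h (t + ((-a : ℝ) : ℂ) * I) - h (t + (a : ℂ) * I)))
      atTop (𝓝 0) := by
    have hz : Tendsto (fun T : ℝ ↦ 2 * ((C + ‖r‖) * |T|⁻¹ * |a - (-a)|)) atTop (𝓝 0) := by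
      have : Tendsto (fun T : ℝ ↦ |T|⁻¹) atTop (𝓝 0) :=
        tendsto_inv_atTop_zero.comp tendsto_abs_atTop_atTop
      simpa using (((this.const_mul (C + ‖r‖)).mul_const (|a - (-a)|)).const_mul 2)
    refine squeeze_zero_norm' ?_ hz
    filter_upwards [eventually_ge_atTop T₀, eventually_ge_atTop 1] with T hT0 hT1
    have hTa : |T| = T := abs_of_pos (by linarith)
    have v1 := hvert T (by linarith) (by rwa [hTa]) (by rwa [hTa])
    have v2 := hvert (-T) (by linarith) (by rwa [abs_neg, hTa]) (by rwa [abs_neg, hTa])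
    rw [abs_neg] at v2
    rw [hrect]
    refine (norm_sub_le _ _).trans ?_
    simp only [norm_mul, Complex.norm_I, one_mul]
    linarith
  have := tendsto_nhds_unique hlim hlim0
  rw [hDval] at this
  linear_combination this

lemma Complex.norm_cot_le {z : ℂ} (hz : z.im ≠ 0) : ‖Complex.cot z‖ ≤ 1 + |z.im|⁻¹ := by
  have him : 0 < |z.im| := abs_pos.2 hz
  have hs : |z.im| ≤ ‖Complex.sin z‖ := by
    have h1 : Complex.normSq (Complex.sin z)
        = Real.sin z.re ^ 2 + Real.sinh z.im ^ 2 := by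
      rw [Complex.sin_eq, Complex.normSq_apply]
      simp only [← Complex.ofReal_sin, ← Complex.ofReal_cos, ← Complex.ofReal_sinh,
        ← Complex.ofReal_cosh, ← Complex.ofReal_mul, Complex.add_re, Complex.add_im,
        Complex.ofReal_re, Complex.ofReal_im, Complex.re_ofReal_mul, Complex.im_ofReal_mul,
        Complex.I_re, Complex.I_im]
      linear_combination Real.sin z.re ^ 2 * Real.cosh_sq z.im
        + Real.sinh z.im ^ 2 * Real.sin_sq_add_cos_sq z.re
    have h2 : |z.im| ≤ |Real.sinh z.im| := by
      rw [Real.abs_sinh]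
      exact Real.self_le_sinh_iff.2 (abs_nonneg _)
    have h3 : |Real.sinh z.im| ^ 2 ≤ ‖Complex.sin z‖ ^ 2 := by
      rw [← Complex.normSq_eq_norm_sq, h1, sq_abs]
      nlinarith [sq_nonneg (Real.sin z.re)]
    exact h2.trans (abs_le_of_sq_le_sq' h3 (norm_nonneg _)).2
  have hc : ‖Complex.cos z‖ ≤ ‖Complex.sin z‖ + 1 := by
    have h1 : ‖Complex.cos z‖ ^ 2 ≤ 1 + ‖Complex.sin z‖ ^ 2 := by
      rw [← norm_pow, ← norm_pow, Complex.cos_sq']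
      exact (norm_sub_le _ _).trans (by simp)
    nlinarith [norm_nonneg (Complex.sin z), norm_nonneg (Complex.cos z)]
  have hs0 : 0 < ‖Complex.sin z‖ := him.trans_le hs
  rw [Complex.cot, norm_div]
  calc ‖Complex.cos z‖ / ‖Complex.sin z‖ ≤ (‖Complex.sin z‖ + 1) / ‖Complex.sin z‖ := by gcongr
    _ = 1 + ‖Complex.sin z‖⁻¹ := by field_simp
    _ ≤ 1 + |z.im|⁻¹ := by gcongr

lemma Complex.norm_cpow_le_exp {x : ℂ} (hx : x ≠ 0) (w : ℂ) :
    ‖x ^ w‖ ≤ Real.exp ((‖x‖ + ‖x‖⁻¹ + π) * ‖w‖) := by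
  have hx' : 0 < ‖x‖ := norm_pos_iff.2 hx
  rw [Complex.cpow_def_of_ne_zero hx, Complex.norm_exp]
  gcongr
  refine (Complex.re_le_norm _).trans ?_
  rw [norm_mul]
  gcongr
  refine (Complex.norm_le_abs_re_add_abs_im _).trans ?_
  rw [Complex.log_re, Complex.log_im]
  gcongr
  · rw [abs_le]
    have h1 := Real.log_le_sub_one_of_pos hx'
    have h2 := Real.log_le_sub_one_of_pos (inv_pos.2 hx')
    rw [Real.log_inv] at h2
    have := inv_pos.2 hx'
    constructor <;> linarith
  · exact Complex.abs_arg_le_pi x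

lemma exists_forall_norm_siegelW_le {m : ℕ} (hm : 0 < m) (χ : DirichletCharacter ℂ m) {δ : ℝ}
    (hδ : 0 < δ) : ∃ K, 0 ≤ K ∧ ∀ x : ℂ, δ ≤ |x.im| → ‖siegelW m χ x‖ ≤ K := by
  have hm' : (0 : ℝ) < m := by exact_mod_cast hm
  refine ⟨‖(π : ℂ) / (2 * (m : ℂ))‖ * ∑ n ∈ Finset.Icc 1 (2 * m),
      ‖χ (n : ZMod m) * Complex.exp (-(I * (π : ℂ) * (n : ℂ) ^ 2 / (m : ℂ)))‖ *
        (1 + (π / (2 * m) * δ)⁻¹), by positivity, fun x hx ↦ ?_⟩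
  rw [siegelW, norm_mul]
  gcongr
  refine (norm_sum_le _ _).trans (Finset.sum_le_sum fun n _ ↦ ?_)
  rw [norm_mul]
  gcongr
  have him : ((π : ℂ) * (x - (n : ℂ)) / (2 * (m : ℂ))).im = π / (2 * m) * x.im := by
    have : (π : ℂ) * (x - (n : ℂ)) / (2 * (m : ℂ))
        = ((π / (2 * m) : ℝ) : ℂ) * (x - ((n : ℝ) : ℂ)) := by
      push_cast
      ring
    rw [this, Complex.im_ofReal_mul]
    simp
  have hle : π / (2 * m) * δ ≤ |((π : ℂ) * (x - (n : ℂ)) / (2 * (m : ℂ))).im| := by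
    rw [him, abs_mul, abs_of_pos (by positivity : (0 : ℝ) < π / (2 * m))]
    gcongr
  have hpos : 0 < π / (2 * m) * δ := by positivity
  refine (Complex.norm_cot_le (abs_pos.1 (hpos.trans_le hle))).trans ?_
  gcongr

lemma exp_neg_mul_sq_add_le {β B : ℝ} (hβ : 0 < β) (t : ℝ) :
    Real.exp (-β * t ^ 2 + B * |t|)
      ≤ 2 * Real.exp ((B + 1) ^ 2 / (4 * β)) * (1 + t ^ 2)⁻¹ := by
  have h1 : 1 + t ^ 2 ≤ 2 * Real.exp |t| := by
    have := Real.quadratic_le_exp_of_nonneg (abs_nonneg t)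
    rw [sq_abs] at this
    linarith [abs_nonneg t]
  have h2 : Real.exp (-β * t ^ 2 + B * |t|) * Real.exp |t| ≤ Real.exp ((B + 1) ^ 2 / (4 * β)) := by
    rw [← Real.exp_add]
    gcongr
    rw [le_div_iff₀ (by positivity), ← sq_abs t]
    nlinarith [sq_nonneg (2 * β * |t| - (B + 1))]
  rw [← div_eq_mul_inv, le_div_iff₀ (by positivity)]
  calc _ ≤ Real.exp (-β * t ^ 2 + B * |t|) * (2 * Real.exp |t|) := by gcongr
    _ ≤ _ := by linarith

/-- The integrand of `siegelLambda`. -/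
noncomputable def siegelIntegrand (m : ℕ) (χ : DirichletCharacter ℂ m) (s x : ℂ) : ℂ :=
  Complex.exp ((I * (π : ℂ) / (m : ℂ)) * x ^ 2) * x ^ (-s) * siegelW m χ x

lemma exp_I_mul_pi_div_four :
    Complex.exp (I * (π : ℂ) / 4) = ((√2 / 2 : ℝ) : ℂ) * (1 + I) := by
  rw [show I * (π : ℂ) / 4 = ((π / 4 : ℝ) : ℂ) * I by push_cast; ring, Complex.exp_mul_I,
    ← Complex.ofReal_cos, ← Complex.ofReal_sin, Real.cos_pi_div_four, Real.sin_pi_div_four]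
  ring

lemma re_add_exp_mul (c t y : ℝ) :
    ((c : ℂ) + Complex.exp (I * (π : ℂ) / 4) * (t + y * I)).re = c + √2 / 2 * (t - y) := by
  rw [exp_I_mul_pi_div_four, mul_assoc, Complex.add_re, Complex.re_ofReal_mul]
  simp

lemma im_add_exp_mul (c t y : ℝ) :
    ((c : ℂ) + Complex.exp (I * (π : ℂ) / 4) * (t + y * I)).im = √2 / 2 * (t + y) := by
  rw [exp_I_mul_pi_div_four, mul_assoc, Complex.add_im, Complex.im_ofReal_mul]
  simp [add_comm]

lemma norm_siegelIntegrand_le {m : ℕ} (hm : 0 < m) (χ : DirichletCharacter ℂ m) (s : ℂ) (c : ℝ) :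
    ∃ C, ∀ t y : ℝ, |y| ≤ √2 / 4 → 1 ≤ |t| →
      ‖siegelIntegrand m χ s (c + Complex.exp (I * (π : ℂ) / 4) * (t + y * I))‖
        ≤ C * (1 + t ^ 2)⁻¹ := by
  have hm' : (0 : ℝ) < m := by exact_mod_cast hm
  obtain ⟨K, hK, hW⟩ := exists_forall_norm_siegelW_le hm χ (δ := 1 / 4) (by norm_num)
  have hq : (√2) ^ 2 = 2 := Real.sq_sqrt (by norm_num)
  have hq0 : 0 ≤ √2 := Real.sqrt_nonneg 2
  have hq1 : 1.4 ≤ √2 := Real.le_sqrt_of_sq_le (by norm_num)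
  have hq2 : √2 ≤ 1.5 := Real.sqrt_le_iff.2 (by norm_num)
  set β : ℝ := π / m with hβ
  have hβ0 : 0 < β := by positivity
  set B : ℝ := 2 * β * |c| + ‖s‖ with hB
  set D : ℝ := β * (1 + 2 * |c|) + (|c| + 5 + π) * ‖s‖ with hD
  refine ⟨Real.exp D * (2 * Real.exp ((B + 1) ^ 2 / (4 * β))) * K, fun t y hy ht ↦ ?_⟩
  set x : ℂ := c + Complex.exp (I * (π : ℂ) / 4) * (t + y * I) with hx
  have hre : x.re = c + √2 / 2 * (t - y) := re_add_exp_mul c t y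
  have him : x.im = √2 / 2 * (t + y) := im_add_exp_mul c t y
  have hty : |t| - |y| ≤ |t + y| := by
    simpa using abs_sub_abs_le_abs_sub t (-y)
  have him4 : 1 / 4 ≤ |x.im| := by
    rw [him, abs_mul, abs_of_nonneg (by positivity)]
    nlinarith
  have hxn : |x.im| ≤ ‖x‖ := Complex.abs_im_le_norm x
  have hxpos : 0 < ‖x‖ := by linarith
  have hxinv : ‖x‖⁻¹ ≤ 4 := by
    rw [inv_le_comm₀ hxpos (by norm_num)]
    linarith
  have hxle : ‖x‖ ≤ |c| + |t| + 1 := by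
    have h1 : ‖Complex.exp (I * (π : ℂ) / 4)‖ = 1 := by
      rw [Complex.norm_exp]
      simp
    have h2 : ‖(t : ℂ) + y * I‖ ≤ |t| + |y| :=
      (norm_add_le _ _).trans (by simp)
    have h3 : ‖x‖ ≤ ‖(c : ℂ)‖ + ‖Complex.exp (I * (π : ℂ) / 4) * (t + y * I)‖ := norm_add_le _ _
    rw [norm_mul, h1, one_mul, Complex.norm_real, Real.norm_eq_abs] at h3
    linarith
  have hpow : ‖x ^ (-s)‖ ≤ Real.exp ((|c| + |t| + 5 + π) * ‖s‖) := by
    refine (Complex.norm_cpow_le_exp (norm_pos_iff.1 hxpos) (-s)).trans ?_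
    rw [norm_neg]
    exact Real.exp_le_exp.2 (mul_le_mul_of_nonneg_right (by linarith) (norm_nonneg s))
  have hexp : ‖Complex.exp ((I * (π : ℂ) / (m : ℂ)) * x ^ 2)‖
      ≤ Real.exp (-β * t ^ 2 + β * (1 + 2 * |c| * (|t| + 1))) := by
    rw [Complex.norm_exp]
    gcongr
    have h1 : (I * (π : ℂ) / (m : ℂ)) * x ^ 2 = (β : ℂ) * (I * x ^ 2) := by
      rw [hβ]
      push_cast
      ring
    have h2 : (I * x ^ 2).re = -(2 * x.re * x.im) := by
      simp [sq]
      ring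
    rw [h1, Complex.re_ofReal_mul, h2]
    have h3 : t ^ 2 - 1 - 2 * |c| * (|t| + 1) ≤ 2 * x.re * x.im := by
      have h4 : 2 * x.re * x.im = √2 * (c * (t + y)) + (t ^ 2 - y ^ 2) := by
        rw [hre, him]
        linear_combination (t ^ 2 - y ^ 2) / 2 * hq
      have h5 : |√2 * (c * (t + y))| ≤ 2 * (|c| * (|t| + 1)) := by
        rw [abs_mul, abs_mul, abs_of_nonneg hq0]
        gcongr
        · linarith
        · exact (abs_add_le t y).trans (by linarith)
      have h6 : y ^ 2 ≤ 1 := by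
        rw [← sq_abs]
        nlinarith [abs_nonneg y]
      have := (abs_le.1 h5).1
      linarith
    nlinarith
  rw [siegelIntegrand, norm_mul, norm_mul]
  calc _ ≤ Real.exp (-β * t ^ 2 + β * (1 + 2 * |c| * (|t| + 1)))
        * Real.exp ((|c| + |t| + 5 + π) * ‖s‖) * K := by
        gcongr
        exact hW x him4
    _ = Real.exp D * Real.exp (-β * t ^ 2 + B * |t|) * K := by
        rw [← Real.exp_add, ← Real.exp_add, hD, hB]
        ring_nf
    _ ≤ Real.exp D * (2 * Real.exp ((B + 1) ^ 2 / (4 * β)) * (1 + t ^ 2)⁻¹) * K := by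
        gcongr
        exact exp_neg_mul_sq_add_le hβ0 t
    _ = _ := by ring

lemma siegelLambda_eq_integral_siegelIntegrand (m : ℕ) (χ : DirichletCharacter ℂ m) (s : ℂ)
    (c d : ℝ) :
    siegelLambda m χ s (c - d) = -(Complex.exp (I * (π : ℂ) / 4) *
      ∫ t : ℝ, siegelIntegrand m χ s
        (c + Complex.exp (I * (π : ℂ) / 4) * (t + ((√2 / 2 * d : ℝ) : ℂ) * I))) := by
  rw [siegelLambda, ← integral_sub_right_eq_self (fun t : ℝ ↦ siegelIntegrand m χ s
        (c + Complex.exp (I * (π : ℂ) / 4) * (t + ((√2 / 2 * d : ℝ) : ℂ) * I))) (√2 / 2 * d)]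
  congr 3 with t
  have hq : (((√2 : ℝ) : ℂ)) ^ 2 = 2 := by
    exact_mod_cast Real.sq_sqrt (show (0 : ℝ) ≤ 2 by norm_num)
  have : ((c - d : ℝ) : ℂ) + Complex.exp (I * (π : ℂ) / 4) * (t : ℂ)
      = c + Complex.exp (I * (π : ℂ) / 4) *
        (((t - √2 / 2 * d : ℝ) : ℂ) + ((√2 / 2 * d : ℝ) : ℂ) * I) := by
    rw [exp_I_mul_pi_div_four]
    push_cast
    linear_combination (d / 4 * (1 - I ^ 2) : ℂ) * hq - (d / 2 : ℂ) * Complex.I_sq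
  rw [this, siegelIntegrand]

/-- In the open strip around the rotated line through an integer, that integer is the only one. -/
lemma eq_zero_of_add_exp_mul_eq_intCast {N k : ℤ} {z : ℂ} (hz : |z.im| < √2 / 2)
    (h : (N : ℂ) + Complex.exp (I * (π : ℂ) / 4) * z = k) : z = 0 := by
  have hq : (√2) ^ 2 = 2 := Real.sq_sqrt (by norm_num)
  have hq0 : 0 < √2 := by positivity
  have h' : (((N : ℝ) : ℂ)) + Complex.exp (I * (π : ℂ) / 4) * (z.re + z.im * I) = ((k : ℝ) : ℂ) := by
    rw [Complex.re_add_im]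
    exact_mod_cast h
  have hre := congrArg Complex.re h'
  have him := congrArg Complex.im h'
  rw [re_add_exp_mul, Complex.ofReal_re] at hre
  rw [im_add_exp_mul, Complex.ofReal_im] at him
  have h1 : z.re = -z.im := by
    rcases mul_eq_zero.1 him with h | h <;> linarith
  rw [h1] at hre
  have h2 : ((k - N : ℤ) : ℝ) = -(√2 * z.im) := by
    push_cast
    linarith
  have h3 : |((k - N : ℤ) : ℝ)| < 1 := by
    rw [h2, abs_neg, abs_mul, abs_of_pos hq0]
    nlinarith
  have h4 : k - N = 0 := Int.abs_lt_one_iff.1 (by exact_mod_cast h3)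
  rw [h4] at h2
  have h5 : z.im = 0 := by
    have : √2 * z.im = 0 := by simpa using h2.symm
    exact (mul_eq_zero.1 this).resolve_left hq0.ne'
  apply Complex.ext <;> simp [h1, h5]

lemma add_exp_mul_mem_slitPlane {c : ℝ} (hc : 1 ≤ c) {z : ℂ} (hz : |z.im| < √2 / 2) :
    (c : ℂ) + Complex.exp (I * (π : ℂ) / 4) * z ∈ Complex.slitPlane := by
  have hq : (√2) ^ 2 = 2 := Real.sq_sqrt (by norm_num)
  have hq0 : 0 < √2 := by positivity
  rw [Complex.mem_slitPlane_iff, ← Complex.re_add_im z, re_add_exp_mul, im_add_exp_mul]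
  by_contra! h
  have h1 : z.re = -z.im := by
    rcases mul_eq_zero.1 h.2 with h | h <;> linarith
  have h2 := (abs_lt.1 hz).2
  rw [h1] at h
  nlinarith [h.1]

lemma mul_sub_div_eq_int_mul_pi {m : ℕ} (hm : 0 < m) {x : ℂ} {n : ℕ} {k : ℤ}
    (h : (π : ℂ) * (x - n) / (2 * m) = k * π) : x = ((n + 2 * m * k : ℤ) : ℂ) := by
  have hm' : (m : ℂ) ≠ 0 := by exact_mod_cast hm.ne'
  have hπ : (π : ℂ) ≠ 0 := by exact_mod_cast Real.pi_ne_zero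
  field_simp at h
  push_cast
  linear_combination h

lemma differentiableOn_siegelIntegrand {m : ℕ} (hm : 0 < m) (χ : DirichletCharacter ℂ m) (s : ℂ)
    {N : ℕ} (hN : 1 ≤ N) :
    DifferentiableOn ℂ
      (fun z ↦ siegelIntegrand m χ s (N + Complex.exp (I * (π : ℂ) / 4) * z))
      ({z : ℂ | |z.im| < √2 / 2} \ {0}) := by
  rintro z ⟨hz, hz0⟩
  refine DifferentiableAt.differentiableWithinAt ?_
  have hslit : (N : ℂ) + Complex.exp (I * (π : ℂ) / 4) * z ∈ Complex.slitPlane := by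
    have := add_exp_mul_mem_slitPlane (c := N) (by exact_mod_cast hN) hz
    exact_mod_cast this
  unfold siegelIntegrand siegelW Complex.cot
  refine DifferentiableAt.mul (DifferentiableAt.mul (by fun_prop) ?_) ?_
  · exact DifferentiableAt.cpow_const (by fun_prop) hslit
  · refine DifferentiableAt.const_mul (DifferentiableAt.fun_sum fun n _ ↦ ?_) _
    refine DifferentiableAt.const_mul (DifferentiableAt.div (by fun_prop) (by fun_prop) ?_) _
    rw [Ne, Complex.sin_eq_zero_iff]
    rintro ⟨k, hk⟩
    exact hz0 (eq_zero_of_add_exp_mul_eq_intCast (N := N) (k := n + 2 * m * k) hz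
      (by simpa using mul_sub_div_eq_int_mul_pi hm hk))

open Classical in
/-- The residue of `cot ∘ g` at a simple zero of `sin ∘ g`, and at a regular point. -/
lemma tendsto_mul_cot {g : ℂ → ℂ} {g' : ℂ} (hg : HasDerivAt g g' 0) (hg' : g' ≠ 0) :
    Tendsto (fun z ↦ z * Complex.cot (g z)) (𝓝[≠] 0)
      (𝓝 (if Complex.sin (g 0) = 0 then g'⁻¹ else 0)) := by
  have hid : Tendsto (fun z : ℂ ↦ z) (𝓝[≠] 0) (𝓝 0) := tendsto_nhdsWithin_of_tendsto_nhds tendsto_id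
  have hcos : Tendsto (fun z ↦ Complex.cos (g z)) (𝓝[≠] 0) (𝓝 (Complex.cos (g 0))) :=
    (Complex.continuous_cos.continuousAt.comp hg.continuousAt).continuousWithinAt
  have hsin : Tendsto (fun z ↦ Complex.sin (g z)) (𝓝[≠] 0) (𝓝 (Complex.sin (g 0))) :=
    (Complex.continuous_sin.continuousAt.comp hg.continuousAt).continuousWithinAt
  split_ifs with h
  · have hc : Complex.cos (g 0) ≠ 0 := fun h0 ↦ by
      simpa [h, h0] using Complex.sin_sq_add_cos_sq (g 0)
    have hslope := hg.csin.tendsto_slope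
    have := hcos.div hslope (mul_ne_zero hc hg')
    rw [div_mul_cancel_left₀ hc] at this
    refine this.congr' ?_
    filter_upwards [self_mem_nhdsWithin] with z hz
    have hz' : z ≠ 0 := hz
    simp only [Pi.div_apply, slope_def_field, h, sub_zero, Complex.cot]
    rw [div_div_eq_mul_div]
    ring
  · simpa [Complex.cot] using hid.mul (hcos.div hsin h)

lemma tendsto_mul_siegelW {m : ℕ} (hm : 0 < m) (χ : DirichletCharacter ℂ m) (N : ℕ) :
    Tendsto (fun z ↦ z * siegelW m χ (N + Complex.exp (I * (π : ℂ) / 4) * z)) (𝓝[≠] 0)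
      (𝓝 ((Complex.exp (I * (π : ℂ) / 4))⁻¹ *
        (χ (N : ZMod m) * Complex.exp (-(I * (π : ℂ) * (N : ℂ) ^ 2 / (m : ℂ)))))) := by
  classical
  have hm' : (m : ℂ) ≠ 0 := by exact_mod_cast hm.ne'
  have hπ : (π : ℂ) ≠ 0 := by exact_mod_cast Real.pi_ne_zero
  set ω := Complex.exp (I * (π : ℂ) / 4) with hω
  have hω0 : ω ≠ 0 := Complex.exp_ne_zero _
  set α : ℂ := (π : ℂ) * ω / (2 * m) with hα
  have hα0 : α ≠ 0 := div_ne_zero (mul_ne_zero hπ hω0) (mul_ne_zero two_ne_zero hm')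
  have hcot (n : ℕ) := tendsto_mul_cot (g := fun z : ℂ ↦ (π : ℂ) * (N + ω * z - n) / (2 * m))
    (g' := α) (by
      have := (((((hasDerivAt_id (0 : ℂ)).const_mul ω).const_add (N : ℂ)).sub_const
        (n : ℂ)).const_mul (π : ℂ)).div_const (2 * (m : ℂ))
      simpa [hα] using this) hα0
  have hsum := (tendsto_finsetSum (Finset.Icc 1 (2 * m)) fun n _ ↦ (hcot n).const_mul
    (χ (n : ZMod m) * Complex.exp (-(I * (π : ℂ) * (n : ℂ) ^ 2 / (m : ℂ))))).const_mul
    ((π : ℂ) / (2 * (m : ℂ)))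
  set n₀ : ℕ := (N + 2 * m - 1) % (2 * m) + 1 with hn₀
  obtain ⟨j, hj⟩ : ∃ j : ℤ, (N : ℤ) = n₀ + 2 * m * j := by
    refine ⟨(((N + 2 * m - 1) / (2 * m) : ℕ) : ℤ) - 1, ?_⟩
    have h1 := Nat.mod_add_div (N + 2 * m - 1) (2 * m)
    have h2 : n₀ + 2 * m * ((N + 2 * m - 1) / (2 * m)) = N + 2 * m := by omega
    have h3 : (n₀ : ℤ) + 2 * m * (((N + 2 * m - 1) / (2 * m) : ℕ) : ℤ) = N + 2 * m := by
      exact_mod_cast h2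
    linarith
  have hn₀mem : n₀ ∈ Finset.Icc 1 (2 * m) := by
    have := Nat.mod_lt (N + 2 * m - 1) (show 0 < 2 * m by omega)
    rw [Finset.mem_Icc]
    omega
  have hjc : (N : ℂ) = n₀ + 2 * m * j := by exact_mod_cast congrArg (Int.cast : ℤ → ℂ) hj
  have hχ : χ (n₀ : ZMod m) = χ (N : ZMod m) := by
    have := congrArg (Int.cast : ℤ → ZMod m) hj
    push_cast at this
    rw [this]
    simp
  have he : Complex.exp (-(I * (π : ℂ) * (n₀ : ℂ) ^ 2 / (m : ℂ)))
      = Complex.exp (-(I * (π : ℂ) * (N : ℂ) ^ 2 / (m : ℂ))) := by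
    rw [Complex.exp_eq_exp_iff_exists_int]
    refine ⟨2 * n₀ * j + 2 * m * j ^ 2, ?_⟩
    rw [hjc]
    push_cast
    field_simp
    ring
  have hlim : (π : ℂ) / (2 * (m : ℂ)) * ∑ n ∈ Finset.Icc 1 (2 * m),
      χ (n : ZMod m) * Complex.exp (-(I * (π : ℂ) * (n : ℂ) ^ 2 / (m : ℂ))) *
        (if Complex.sin ((π : ℂ) * (N + ω * 0 - n) / (2 * m)) = 0 then α⁻¹ else 0)
      = ω⁻¹ * (χ (N : ZMod m) * Complex.exp (-(I * (π : ℂ) * (N : ℂ) ^ 2 / (m : ℂ)))) := by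
    rw [Finset.sum_eq_single_of_mem n₀ hn₀mem]
    · rw [if_pos, hχ, he, hα]
      · field_simp
      · rw [Complex.sin_eq_zero_iff]
        refine ⟨j, ?_⟩
        rw [hjc]
        field_simp
        ring
    · intro n hn hne
      rw [if_neg, mul_zero]
      rw [Complex.sin_eq_zero_iff]
      rintro ⟨k, hk⟩
      have h1 := mul_sub_div_eq_int_mul_pi hm hk
      rw [mul_zero, add_zero] at h1
      have h2 : (N : ℤ) = n + 2 * m * k := by exact_mod_cast h1
      rw [Finset.mem_Icc] at hn hn₀mem
      have h3 : (n : ℤ) - n₀ = 2 * m * (j - k) := by linarith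
      have h4 : |(n : ℤ) - n₀| < 2 * m := by
        rw [abs_lt]
        omega
      have h5 : (n : ℤ) - n₀ = 0 := Int.eq_zero_of_abs_lt_dvd ⟨_, h3⟩ h4
      omega
  rw [hlim] at hsum
  refine hsum.congr fun z ↦ ?_
  rw [siegelW, Finset.mul_sum, Finset.mul_sum, Finset.mul_sum]
  refine Finset.sum_congr rfl fun n _ ↦ ?_
  ring

lemma tendsto_mul_siegelIntegrand {m : ℕ} (hm : 0 < m) (χ : DirichletCharacter ℂ m) (s : ℂ)
    {N : ℕ} (hN : 1 ≤ N) :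
    Tendsto (fun z ↦ z * siegelIntegrand m χ s (N + Complex.exp (I * (π : ℂ) / 4) * z)) (𝓝[≠] 0)
      (𝓝 ((Complex.exp (I * (π : ℂ) / 4))⁻¹ * (χ (N : ZMod m) * (N : ℂ) ^ (-s)))) := by
  have hc : ContinuousAt (fun z ↦ Complex.exp ((I * (π : ℂ) / (m : ℂ))
      * ((N : ℂ) + Complex.exp (I * (π : ℂ) / 4) * z) ^ 2)
      * ((N : ℂ) + Complex.exp (I * (π : ℂ) / 4) * z) ^ (-s)) 0 := by
    refine ContinuousAt.mul (by fun_prop) (ContinuousAt.cpow (by fun_prop) continuousAt_const ?_)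
    simp only [mul_zero, add_zero]
    rw [Complex.natCast_mem_slitPlane]
    omega
  have hlim := (hc.continuousWithinAt (s := {0}ᶜ)).tendsto.mul (tendsto_mul_siegelW hm χ N)
  have he : Complex.exp (I * (π : ℂ) / (m : ℂ) * (N : ℂ) ^ 2)
      * Complex.exp (-(I * (π : ℂ) * (N : ℂ) ^ 2 / (m : ℂ))) = 1 := by
    rw [← Complex.exp_add, ← Complex.exp_zero]
    congr 1
    ring
  have hval : Complex.exp ((I * (π : ℂ) / (m : ℂ))
      * ((N : ℂ) + Complex.exp (I * (π : ℂ) / 4) * 0) ^ 2)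
      * ((N : ℂ) + Complex.exp (I * (π : ℂ) / 4) * 0) ^ (-s)
      * ((Complex.exp (I * (π : ℂ) / 4))⁻¹ *
        (χ (N : ZMod m) * Complex.exp (-(I * (π : ℂ) * (N : ℂ) ^ 2 / (m : ℂ)))))
      = (Complex.exp (I * (π : ℂ) / 4))⁻¹ * (χ (N : ZMod m) * (N : ℂ) ^ (-s)) := by
    rw [mul_zero, add_zero]
    linear_combination
      ((Complex.exp (I * (π : ℂ) / 4))⁻¹ * (χ (N : ZMod m) * (N : ℂ) ^ (-s))) * he
  rw [hval] at hlim
  refine hlim.congr fun z ↦ ?_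
  rw [siegelIntegrand]
  ring

/-- **Residue of the Siegel contour integral at the pole `x = N`**: shifting the
contour from `N - 1/2` to `N + 1/2` picks up exactly the term `χ(N) N^{-s}`:
`(1/(2πi)) (Λ(N - 1/2) - Λ(N + 1/2)) = χ(N) N^{-s}`. -/
theorem siegelLambda_residue (m : ℕ) (hm : 0 < m) (χ : DirichletCharacter ℂ m)
    (s : ℂ) (N : ℕ) (hN : 1 ≤ N) :
    (1 / (2 * (π : ℂ) * I)) *
        (siegelLambda m χ s ((N : ℝ) - 1/2) - siegelLambda m χ s ((N : ℝ) + 1/2))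
      = χ (N : ZMod m) * (N : ℂ) ^ (-s) := by
  have hq0 : 0 < √2 := by positivity
  obtain ⟨C, hC⟩ := norm_siegelIntegrand_le hm χ s N
  have hres := integral_sub_integral_strip_eq_residue (a := √2 / 4) (b := √2 / 2) (by positivity)
    (by linarith) (differentiableOn_siegelIntegrand hm χ s hN)
    (tendsto_mul_siegelIntegrand hm χ s hN) (C := C) (T₀ := 1)
    (fun t y hy ht ↦ by simpa using hC t y hy ht)
  have h1 := siegelLambda_eq_integral_siegelIntegrand m χ s N (1 / 2)
  have h2 := siegelLambda_eq_integral_siegelIntegrand m χ s N (-(1 / 2))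
  rw [sub_neg_eq_add] at h2
  rw [show √2 / 2 * (1 / 2) = √2 / 4 by ring] at h1
  rw [show √2 / 2 * -(1 / 2) = -(√2 / 4) by ring] at h2
  rw [Complex.ofReal_natCast] at h1 h2
  rw [h1, h2]
  have hω := Complex.exp_ne_zero (I * (π : ℂ) / 4)
  have hπ : (π : ℂ) ≠ 0 := by exact_mod_cast Real.pi_ne_zero
  have hI := Complex.I_ne_zero
  rw [neg_sub_neg, ← mul_sub, hres]
  field_simp
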